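/- arXiv:1601.07410 — 3 statements merged into one kernel-verified Lean document; each statement's English description precedes it below -/
import Mathlib

section
/- Let φ = 1, λ > 0 and 0 < α ≤ 1/2, and let f be the corresponding GWL density f(t) = α λ^α t^{α−1} (λ + (λ t)^α) e^{−(λ t)^α} / (λ + 1) (a power Lindley density up to rescaling). Then the hazard function h(t) = f(t) / ∫_t^∞ f(x) dx is decreasing on (0, ∞): for all 0 < t₁ ≤ t₂, h(t₁) ≥ h(t₂). -/
open MeasureTheory Real

/-- The power Lindley probability density function (GWL density with `φ = 1`). -/
noncomputable def plPdf (lam α t : ℝ) : ℝ :=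
  α * lam ^ α * t ^ (α - 1) * (lam + (lam * t) ^ α) * Real.exp (-(lam * t) ^ α) /
    (lam + 1)

/-- The hazard function of the power Lindley distribution. -/
noncomputable def plHazard (lam α t : ℝ) : ℝ :=
  plPdf lam α t / ∫ x in Set.Ioi t, plPdf lam α x


lemma pl_survival (lam α t : ℝ) (hlam : 0 < lam) (hα0 : 0 < α) (ht : 0 < t) :
    ∫ x in Set.Ioi t, plPdf lam α x =
      (lam + 1 + (lam * t) ^ α) * Real.exp (-(lam * t) ^ α) / (lam + 1) := by
  have hd : ∀ x ∈ Set.Ici t, HasDerivAt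
      (fun x => -((lam + 1 + (lam * x) ^ α) * Real.exp (-(lam * x) ^ α) / (lam + 1)))
      (plPdf lam α x) x := by
    intro x hx
    have hx0 : 0 < x := lt_of_lt_of_le ht hx
    have h1 : HasDerivAt (fun x => (lam * x) ^ α) (lam * 1 * α * (lam * x) ^ (α - 1)) x :=
      ((hasDerivAt_id x).const_mul lam).rpow_const (Or.inl (by simp; constructor <;> positivity))
    have h2 := (((h1.const_add (lam + 1)).mul h1.neg.exp).div_const (lam + 1)).neg
    refine h2.congr_deriv ?_
    have e : (lam * x) ^ (α - 1) * lam = lam ^ α * x ^ (α - 1) := by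
      rw [Real.mul_rpow hlam.le hx0.le, Real.rpow_sub_one hlam.ne']
      field_simp
    have e' : plPdf lam α x = α * (lam ^ α * x ^ (α - 1)) * (lam + (lam * x) ^ α) *
        Real.exp (-(lam * x) ^ α) / (lam + 1) := by unfold plPdf; ring
    rw [e', ← e]
    simp only [Pi.neg_apply]
    ring
  have hl : Filter.Tendsto
      (fun x => -((lam + 1 + (lam * x) ^ α) * Real.exp (-(lam * x) ^ α) / (lam + 1)))
      Filter.atTop (nhds 0) := by
    have hu : Filter.Tendsto (fun x : ℝ => (lam * x) ^ α) Filter.atTop Filter.atTop :=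
      (tendsto_rpow_atTop hα0).comp (Filter.tendsto_id.const_mul_atTop hlam)
    have h0 : Filter.Tendsto (fun u : ℝ => Real.exp (-u)) Filter.atTop (nhds 0) :=
      Real.tendsto_exp_neg_atTop_nhds_zero
    have h1 : Filter.Tendsto (fun u : ℝ => u ^ 1 * Real.exp (-u)) Filter.atTop (nhds 0) :=
      Real.tendsto_pow_mul_exp_neg_atTop_nhds_zero 1
    have h2 := ((((h0.const_mul (lam + 1)).add h1).div_const (lam + 1)).neg).comp hu
    simp only [mul_zero, add_zero, zero_div, neg_zero] at h2
    refine h2.congr fun x => ?_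
    simp only [Function.comp]
    ring
  rw [integral_Ioi_of_hasDerivAt_of_nonneg' hd ?_ hl]
  · ring
  · intro x hx
    have hx0 : 0 < x := lt_trans ht hx
    unfold plPdf
    positivity

lemma pl_hazard_eq (lam α t : ℝ) (hlam : 0 < lam) (hα0 : 0 < α) (ht : 0 < t) :
    plHazard lam α t = α * lam ^ α * (t ^ (2 * α - 1) *
      ((lam + lam ^ α * t ^ α) / (t ^ α * (lam + 1 + lam ^ α * t ^ α)))) := by
  unfold plHazard
  rw [pl_survival lam α t hlam hα0 ht]
  unfold plPdf
  have e : t ^ (2 * α - 1) = t ^ (α - 1) * t ^ α := by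
    rw [← Real.rpow_add ht]; ring_nf
  rw [e, ← Real.mul_rpow hlam.le ht.le]
  have : 0 < t ^ α := by positivity
  have : 0 < (lam * t) ^ α := by positivity
  have := Real.exp_pos (-(lam * t) ^ α)
  field_simp

theorem pl_hazard_decreasing (lam α : ℝ) (hlam : 0 < lam) (hα0 : 0 < α)
    (hα : α ≤ 1 / 2) :
    ∀ t₁ t₂ : ℝ, 0 < t₁ → t₁ ≤ t₂ → plHazard lam α t₂ ≤ plHazard lam α t₁ := by
  intro t₁ t₂ h1 h12
  have h2 : 0 < t₂ := lt_of_lt_of_le h1 h12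
  rw [pl_hazard_eq lam α t₁ hlam hα0 h1, pl_hazard_eq lam α t₂ hlam hα0 h2]
  have hA : t₂ ^ (2 * α - 1) ≤ t₁ ^ (2 * α - 1) :=
    Real.rpow_le_rpow_of_nonpos h1 h12 (by linarith)
  have hs : t₁ ^ α ≤ t₂ ^ α := Real.rpow_le_rpow h1.le h12 hα0.le
  have hs1 : 0 < t₁ ^ α := by positivity
  have hc : 0 < lam ^ α := by positivity
  have hB : (lam + lam ^ α * t₂ ^ α) / (t₂ ^ α * (lam + 1 + lam ^ α * t₂ ^ α)) ≤
      (lam + lam ^ α * t₁ ^ α) / (t₁ ^ α * (lam + 1 + lam ^ α * t₁ ^ α)) := by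
    generalize t₁ ^ α = a at *
    generalize t₂ ^ α = b at *
    generalize lam ^ α = c at *
    have hb : 0 < b := by linarith
    rw [div_le_div_iff₀ (by positivity) (by positivity)]
    have : 0 ≤ (b - a) * (lam * (lam + 1) + lam * c * (a + b) + c ^ 2 * (a * b)) :=
      mul_nonneg (by linarith) (by positivity)
    nlinarith
  have : 0 ≤ t₁ ^ (2 * α - 1) := by positivity
  gcongr
end

section
/- Let φ > 0, λ > 0 and α = 1, and let f be the corresponding GWL density (the weighted Lindley density) with survival function S(t) = ∫_t^∞ f(x) dx and mean residual life r(t) = (1/S(t)) ∫_t^∞ y f(y) dy − t. Then r(t) → 1/λ as t → ∞. -/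
open MeasureTheory Real Filter

/-- The weighted Lindley probability density function (GWL density with `α = 1`). -/
noncomputable def wlPdf (φ lam t : ℝ) : ℝ :=
  lam ^ (φ + 1) * t ^ (φ - 1) * (1 + t) * Real.exp (-(lam * t)) /
    ((lam + φ) * Real.Gamma φ)

/-- The mean residual life function of the weighted Lindley distribution. -/
noncomputable def wlMrl (φ lam t : ℝ) : ℝ :=
  (1 / ∫ x in Set.Ioi t, wlPdf φ lam x) *
    (∫ y in Set.Ioi t, y * wlPdf φ lam y) - t

lemma tail_eq {g : ℝ → ℝ} (hi : IntegrableOn g (Set.Ioi 0)) {t : ℝ} (ht : 0 ≤ t) :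
    (∫ x in Set.Ioi t, g x) = (∫ x in Set.Ioi 0, g x) - ∫ x in (0:ℝ)..t, g x := by
  have h2 : IntegrableOn g (Set.Ioi t) := hi.mono_set (Set.Ioi_subset_Ioi ht)
  have h1 : IntegrableOn g (Set.Ioc 0 t) := hi.mono_set Set.Ioc_subset_Ioi_self
  rw [intervalIntegral.integral_of_le ht, ← Set.Ioc_union_Ioi_eq_Ioi ht,
    setIntegral_union (Set.Ioc_disjoint_Ioi le_rfl) measurableSet_Ioi h1 h2]
  ring

lemma tail_deriv {g : ℝ → ℝ} (hi : IntegrableOn g (Set.Ioi 0))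
    (hc : ContinuousOn g (Set.Ioi 0)) {t : ℝ} (ht : 0 < t) :
    HasDerivAt (fun t => ∫ x in Set.Ioi t, g x) (-g t) t := by
  have h1 : IntervalIntegrable g volume 0 t := by
    rw [intervalIntegrable_iff_integrableOn_Ioc_of_le ht.le]
    exact hi.mono_set Set.Ioc_subset_Ioi_self
  have h := intervalIntegral.integral_hasDerivAt_right h1
    (hc.stronglyMeasurableAtFilter isOpen_Ioi t ht) (hc.continuousAt (Ioi_mem_nhds ht))
  refine (h.const_sub (∫ x in Set.Ioi 0, g x)).congr_of_eventuallyEq ?_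
  filter_upwards [Ioi_mem_nhds ht] with s hs
  exact tail_eq hi (le_of_lt hs)

lemma tail_tendsto {g : ℝ → ℝ} (hi : IntegrableOn g (Set.Ioi 0)) :
    Tendsto (fun t => ∫ x in Set.Ioi t, g x) atTop (nhds 0) := by
  have h := (intervalIntegral_tendsto_integral_Ioi 0 hi tendsto_id).const_sub
    (∫ x in Set.Ioi 0, g x)
  rw [sub_self] at h
  refine h.congr' ?_
  filter_upwards [eventually_ge_atTop 0] with s hs
  exact (tail_eq hi hs).symm

lemma wlPdf_eq (φ lam : ℝ) {t : ℝ} (ht : 0 < t) :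
    wlPdf φ lam t = lam ^ (φ + 1) / ((lam + φ) * Real.Gamma φ) *
      (t ^ (φ - 1) * exp (-lam * t) + t ^ φ * exp (-lam * t)) := by
  have : t ^ φ = t ^ (φ - 1) * t := by
    rw [← rpow_add_one ht.ne']; ring_nf
  rw [wlPdf, this]; ring_nf

lemma int_aux {lam s : ℝ} (hlam : 0 < lam) (hs : -1 < s) :
    IntegrableOn (fun x : ℝ => x ^ s * exp (-lam * x)) (Set.Ioi 0) := by
  simpa using integrableOn_rpow_mul_exp_neg_mul_rpow (p := 1) hs one_pos hlam

lemma wlPdf_int {φ lam : ℝ} (hφ : 0 < φ) (hlam : 0 < lam) :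
    IntegrableOn (wlPdf φ lam) (Set.Ioi 0) := by
  refine IntegrableOn.congr_fun (((int_aux hlam (s := φ - 1) (by linarith)).add
    (int_aux hlam (s := φ) (by linarith))).const_mul
      (lam ^ (φ + 1) / ((lam + φ) * Real.Gamma φ))) (fun t ht => ?_) measurableSet_Ioi
  exact (wlPdf_eq φ lam ht).symm

lemma wlPdf_mul_int {φ lam : ℝ} (hφ : 0 < φ) (hlam : 0 < lam) :
    IntegrableOn (fun y => y * wlPdf φ lam y) (Set.Ioi 0) := by
  refine IntegrableOn.congr_fun (((int_aux hlam (s := φ) (by linarith)).add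
    (int_aux hlam (s := φ + 1) (by linarith))).const_mul
      (lam ^ (φ + 1) / ((lam + φ) * Real.Gamma φ))) (fun t ht => ?_) measurableSet_Ioi
  have h0 : t ≠ 0 := ne_of_gt ht
  have h1 : t ^ φ = t ^ (φ - 1) * t := by
    rw [← rpow_add_one h0]; ring_nf
  simp only [Pi.add_apply]
  rw [wlPdf_eq φ lam ht, rpow_add_one h0, h1]
  ring

lemma wlPdf_pos {φ lam : ℝ} (hφ : 0 < φ) (hlam : 0 < lam) {t : ℝ} (ht : 0 < t) :
    0 < wlPdf φ lam t := by
  have := Real.Gamma_pos_of_pos hφ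
  unfold wlPdf
  positivity

lemma wlPdf_deriv (φ lam : ℝ) {t : ℝ} (ht : 0 < t) :
    HasDerivAt (wlPdf φ lam)
      (wlPdf φ lam t * ((φ - 1) * t⁻¹ + (1 + t)⁻¹ - lam)) t := by
  have h1 : HasDerivAt (fun t : ℝ => t ^ (φ - 1)) ((φ - 1) * t ^ (φ - 1 - 1)) t :=
    hasDerivAt_rpow_const (Or.inl ht.ne')
  have h2 : HasDerivAt (fun t : ℝ => 1 + t) 1 t := (hasDerivAt_id t).const_add 1
  have h3 : HasDerivAt (fun t : ℝ => exp (-(lam * t))) (exp (-(lam * t)) * -(lam * 1)) t :=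
    ((hasDerivAt_id t).const_mul lam).neg.exp
  have h := (((h1.const_mul (lam ^ (φ + 1))).mul h2).mul h3).div_const
    ((lam + φ) * Real.Gamma φ)
  refine h.congr_deriv ?_
  have h4 : 1 + t ≠ 0 := by positivity
  rw [wlPdf, rpow_sub_one ht.ne' (φ - 1)]
  generalize (lam + φ) * Real.Gamma φ = D
  simp only [div_eq_mul_inv]
  generalize D⁻¹ = E
  simp only [Pi.mul_apply]
  field_simp
  ring

lemma wlPdf_tendsto {φ lam : ℝ} (hlam : 0 < lam) :
    Tendsto (wlPdf φ lam) atTop (nhds 0) := by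
  have h := ((tendsto_rpow_mul_exp_neg_mul_atTop_nhds_zero (φ - 1) lam hlam).add
    (tendsto_rpow_mul_exp_neg_mul_atTop_nhds_zero φ lam hlam)).const_mul
      (lam ^ (φ + 1) / ((lam + φ) * Real.Gamma φ))
  simp only [add_zero, mul_zero] at h
  refine h.congr' ?_
  filter_upwards [eventually_gt_atTop 0] with t ht
  exact (wlPdf_eq φ lam ht).symm

lemma wl_factor_tendsto (φ lam : ℝ) :
    Tendsto (fun t : ℝ => (φ - 1) * t⁻¹ + (1 + t)⁻¹ - lam) atTop (nhds (-lam)) := by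
  have h1 : Tendsto (fun t : ℝ => (1 + t)⁻¹) atTop (nhds 0) :=
    tendsto_inv_atTop_zero.comp (tendsto_atTop_add_const_left _ 1 tendsto_id)
  simpa using ((tendsto_inv_atTop_zero.const_mul (φ - 1)).add h1).sub_const lam

lemma wl_ratio {φ lam : ℝ} (hφ : 0 < φ) (hlam : 0 < lam) :
    Tendsto (fun t => (∫ x in Set.Ioi t, wlPdf φ lam x) / wlPdf φ lam t) atTop
      (nhds (1 / lam)) := by
  have hc : ContinuousOn (wlPdf φ lam) (Set.Ioi 0) := fun t ht =>
    (wlPdf_deriv φ lam ht).continuousAt.continuousWithinAt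
  have hF := wl_factor_tendsto φ lam
  have hne : ∀ᶠ t : ℝ in atTop, (φ - 1) * t⁻¹ + (1 + t)⁻¹ - lam ≠ 0 :=
    hF.eventually_ne (by linarith)
  refine HasDerivAt.lhopital_zero_atTop (f' := fun t => - wlPdf φ lam t)
    (g' := fun t => wlPdf φ lam t * ((φ - 1) * t⁻¹ + (1 + t)⁻¹ - lam)) ?_ ?_ ?_
    (tail_tendsto (wlPdf_int hφ hlam)) (wlPdf_tendsto hlam) ?_
  · filter_upwards [eventually_gt_atTop 0] with t ht
    exact tail_deriv (wlPdf_int hφ hlam) hc ht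
  · filter_upwards [eventually_gt_atTop 0] with t ht
    exact wlPdf_deriv φ lam ht
  · filter_upwards [eventually_gt_atTop 0, hne] with t ht h
    exact mul_ne_zero (wlPdf_pos hφ hlam ht).ne' h
  · have h := (hF.inv₀ (by linarith)).neg
    have e : -(-lam)⁻¹ = 1 / lam := by rw [inv_neg, neg_neg, one_div]
    rw [e] at h
    refine h.congr' ?_
    filter_upwards [eventually_gt_atTop 0, hne] with t ht h
    have := (wlPdf_pos hφ hlam ht).ne'
    rw [neg_div, div_mul_eq_div_div, div_self this, one_div]

theorem wl_mrl_limit_at_top (φ lam : ℝ) (hφ : 0 < φ) (hlam : 0 < lam) :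
    Tendsto (fun t => wlMrl φ lam t) atTop (nhds (1 / lam)) := by
  have hc : ContinuousOn (wlPdf φ lam) (Set.Ioi 0) := fun t ht =>
    (wlPdf_deriv φ lam ht).continuousAt.continuousWithinAt
  have hi := wlPdf_int hφ hlam
  have hmi := wlPdf_mul_int hφ hlam
  have hS := tail_tendsto hi
  have hM := tail_tendsto hmi
  have hR := wl_ratio hφ hlam
  have htS : Tendsto (fun t => t * ∫ x in Set.Ioi t, wlPdf φ lam x) atTop (nhds 0) := by
    refine tendsto_of_tendsto_of_tendsto_of_le_of_le' tendsto_const_nhds hM ?_ ?_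
    · filter_upwards [eventually_gt_atTop 0] with t ht
      refine mul_nonneg ht.le (setIntegral_nonneg measurableSet_Ioi fun x hx => ?_)
      exact (wlPdf_pos hφ hlam (ht.trans hx)).le
    · filter_upwards [eventually_gt_atTop 0] with t ht
      rw [← integral_const_mul]
      refine setIntegral_mono_on ((hi.mono_set (Set.Ioi_subset_Ioi ht.le)).const_mul t)
        (hmi.mono_set (Set.Ioi_subset_Ioi ht.le)) measurableSet_Ioi fun x hx => ?_
      exact mul_le_mul_of_nonneg_right (le_of_lt hx) (wlPdf_pos hφ hlam (ht.trans hx)).le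
  have hN := hM.sub htS
  rw [sub_zero] at hN
  have key : Tendsto (fun t => ((∫ y in Set.Ioi t, y * wlPdf φ lam y) -
      t * ∫ x in Set.Ioi t, wlPdf φ lam x) / ∫ x in Set.Ioi t, wlPdf φ lam x) atTop
      (nhds (1 / lam)) := by
    refine HasDerivAt.lhopital_zero_atTop (f' := fun t => - ∫ x in Set.Ioi t, wlPdf φ lam x)
      (g' := fun t => - wlPdf φ lam t) ?_ ?_ ?_ hN hS ?_
    · filter_upwards [eventually_gt_atTop 0] with t ht
      have h1 := tail_deriv hmi (continuousOn_id.mul hc) ht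
      have h2 := (hasDerivAt_id t).mul (tail_deriv hi hc ht)
      refine (h1.sub h2).congr_deriv ?_
      simp only [id]
      ring
    · filter_upwards [eventually_gt_atTop 0] with t ht
      exact tail_deriv hi hc ht
    · filter_upwards [eventually_gt_atTop 0] with t ht
      exact neg_ne_zero.mpr (wlPdf_pos hφ hlam ht).ne'
    · simpa only [neg_div_neg_eq] using hR
  refine key.congr' ?_
  filter_upwards [hR.eventually_ne (by positivity : 1 / lam ≠ 0)] with t ht
  have hs : (∫ x in Set.Ioi t, wlPdf φ lam x) ≠ 0 := fun h => ht (by rw [h, zero_div])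
  rw [wlMrl]
  field_simp
end

section
/- Let φ > 0, λ > 0, α > 0 and let f be the GWL density. The Shannon entropy H = −∫₀^∞ f(t) log f(t) dt satisfies H = log(λ + φ) + log Γ(φ) − log α − log λ + φ(1 + φ + λ)/(λ + φ) − ψ(φ)(αφ − 1)/α − (αφ − 1)/(α(λ + φ)) − η(φ, λ)/((λ + φ) Γ(φ)), where ψ = Γ′/Γ is the digamma function and η(φ, λ) = ∫₀^∞ (λ + y) log(λ + y) y^{φ−1} e^{−y} dy. -/
open MeasureTheory Real

/-- The probability density function of the generalized weighted Lindley (GWL)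
distribution with parameters `φ`, `lam`, `α`. -/
noncomputable def gwlPdf (φ lam α t : ℝ) : ℝ :=
  α * lam ^ (α * φ) * t ^ (α * φ - 1) * (lam + (lam * t) ^ α) *
    Real.exp (-(lam * t) ^ α) / ((lam + φ) * Real.Gamma φ)

/-- The digamma function `ψ = Γ'/Γ`. -/
noncomputable def digamma (x : ℝ) : ℝ := deriv Real.Gamma x / Real.Gamma x

/-- The auxiliary integral `η(φ, lam) = ∫₀^∞ (lam + y) log(lam + y) y^(φ-1) e^(-y) dy`. -/
noncomputable def etaAux (φ lam : ℝ) : ℝ :=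
  ∫ y in Set.Ioi (0 : ℝ), (lam + y) * Real.log (lam + y) * y ^ (φ - 1) * Real.exp (-y)

theorem gwl_log_integrable (s : ℝ) (hs : 0 < s) :
    IntegrableOn (fun y : ℝ => Real.log y * (y ^ (s - 1) * Real.exp (-y))) (Set.Ioi 0) ∧
    ∫ y in Set.Ioi (0 : ℝ), Real.log y * (y ^ (s - 1) * Real.exp (-y)) = deriv Real.Gamma s := by
  have hc : 0 < (s : ℂ).re := by simpa using hs
  have hcongr : ∀ t ∈ Set.Ioi (0 : ℝ),
      (t : ℂ) ^ ((s : ℂ) - 1) * ((Real.log t : ℂ) * (Real.exp (-t) : ℂ)) =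
      ((Real.log t * (t ^ (s - 1) * Real.exp (-t)) : ℝ) : ℂ) := by
    intro t ht
    have ht' : (0 : ℝ) ≤ t := le_of_lt ht
    push_cast [Complex.ofReal_cpow ht']
    ring
  have hint : IntegrableOn (fun t : ℝ =>
      (t : ℂ) ^ ((s : ℂ) - 1) * ((Real.log t : ℂ) * (Real.exp (-t) : ℂ))) (Set.Ioi 0) := by
    have := (mellin_hasDerivAt_of_isBigO_rpow (E := ℂ) (f := fun x : ℝ => (Real.exp (-x) : ℂ))
      (a := s + 1) (b := 0) (s := (s : ℂ)) ?_ ?_ (by simp) ?_ hc).1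
    · refine this.congr_fun (fun t ht => ?_) measurableSet_Ioi
      simp
    · refine (Continuous.continuousOn ?_).locallyIntegrableOn measurableSet_Ioi
      exact Complex.continuous_ofReal.comp (Real.continuous_exp.comp continuous_neg)
    · rw [← Asymptotics.isBigO_norm_left]
      simp_rw [Complex.norm_real, Asymptotics.isBigO_norm_left]
      simpa only [neg_one_mul] using (isLittleO_exp_neg_mul_rpow_atTop zero_lt_one _).isBigO
    · simp_rw [neg_zero, Real.rpow_zero]
      refine Asymptotics.isBigO_const_of_tendsto (?_ : Filter.Tendsto _ _ (nhds (1 : ℂ))) one_ne_zero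
      rw [(by simp : (1 : ℂ) = Real.exp (-0))]
      exact (Complex.continuous_ofReal.comp
        (Real.continuous_exp.comp continuous_neg)).continuousWithinAt
  constructor
  · have h2 := hint.congr_fun hcongr measurableSet_Ioi
    have h3 := MeasureTheory.Integrable.re h2
    exact h3
  · have h1 := Complex.hasDerivAt_GammaIntegral hc
    have h2 : HasDerivAt Complex.Gamma _ (s : ℂ) := h1.congr_of_eventuallyEq (by
      filter_upwards [(isOpen_lt continuous_const Complex.continuous_re).mem_nhds hc] with z hz
      exact Complex.Gamma_eq_integral hz)
    have h3 := h2.real_of_complex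
    have h4 : HasDerivAt Real.Gamma _ s := h3
    rw [h4.deriv, setIntegral_congr_fun measurableSet_Ioi hcongr, integral_complex_ofReal,
      Complex.ofReal_re]

theorem gwl_shift (φ k y : ℝ) (hy : 0 < y) : y ^ (φ + k - 1) = y ^ k * y ^ (φ - 1) := by
  rw [← Real.rpow_add hy]; ring_nf

theorem gwl_shannon_entropy (φ lam α : ℝ) (hφ : 0 < φ) (hlam : 0 < lam)
    (hα : 0 < α) :
    -∫ t in Set.Ioi (0 : ℝ), gwlPdf φ lam α t * Real.log (gwlPdf φ lam α t) =
      Real.log (lam + φ) + Real.log (Real.Gamma φ) - Real.log α - Real.log lam +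
        φ * (1 + φ + lam) / (lam + φ) - digamma φ * (α * φ - 1) / α -
        (α * φ - 1) / (α * (lam + φ)) - etaAux φ lam / ((lam + φ) * Real.Gamma φ) := by
  have hG : 0 < Real.Gamma φ := Real.Gamma_pos_of_pos hφ
  have hG1 : Real.Gamma (φ + 1) = φ * Real.Gamma φ := Real.Gamma_add_one hφ.ne'
  have hG2 : Real.Gamma (φ + 2) = (φ + 1) * (φ * Real.Gamma φ) := by
    rw [← hG1, ← Real.Gamma_add_one (by positivity)]; ring_nf
  have hD1 : deriv Real.Gamma (φ + 1) = Real.Gamma φ + φ * deriv Real.Gamma φ := by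
    have e : (fun x : ℝ => Real.Gamma (x + 1)) =ᶠ[nhds φ] fun x => x * Real.Gamma x := by
      filter_upwards [lt_mem_nhds hφ] with x hx
      exact Real.Gamma_add_one hx.ne'
    have hd : DifferentiableAt ℝ Real.Gamma φ :=
      (Real.differentiableOn_Gamma_Ioi.differentiableAt (Ioi_mem_nhds hφ))
    have := e.deriv_eq
    rw [deriv_comp_add_const] at this
    rw [this, deriv_fun_mul differentiableAt_fun_id hd]
    simp
  set C := (lam + φ) * Real.Gamma φ with hC
  have hCpos : 0 < C := by positivity
  set w : ℝ → ℝ := fun y => y ^ (φ - 1) * Real.exp (-y) with hw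
  -- change of variables
  set K := Real.log α + Real.log lam - Real.log C with hK
  set c := (α * φ - 1) / α with hc
  set F : ℝ → ℝ := fun y => ((lam + y) * w y / C) *
    (K + c * Real.log y + Real.log (lam + y) - y) with hF
  have hcv : ∫ t in Set.Ioi (0 : ℝ), gwlPdf φ lam α t * Real.log (gwlPdf φ lam α t) =
      ∫ y in Set.Ioi (0 : ℝ), F y := by
    rw [← integral_comp_rpow_Ioi_of_pos (g := F) hα]
    have := integral_comp_mul_left_Ioi' (fun x => (α * x ^ (α - 1)) • F (x ^ α)) 0 hlam
    rw [mul_zero] at this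
    rw [← this, ← integral_smul]
    refine setIntegral_congr_fun measurableSet_Ioi (fun t ht => ?_)
    have ht : 0 < t := ht
    have hu : 0 < lam * t := by positivity
    have hy : 0 < (lam * t) ^ α := by positivity
    have e1 : gwlPdf φ lam α t =
        lam * (α * (lam * t) ^ (α - 1)) * ((lam + (lam * t) ^ α) * w ((lam * t) ^ α) / C) := by
      have p1 : ((lam * t) ^ α) ^ (φ - 1) = (lam * t) ^ (α * (φ - 1)) := by
        rw [Real.rpow_mul hu.le]
      have p2 : (lam * t) ^ (α - 1) * (lam * t) ^ (α * (φ - 1)) = (lam * t) ^ (α * φ - 1) := by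
        rw [← Real.rpow_add hu]; ring_nf
      have p3 : lam * (lam * t) ^ (α * φ - 1) = lam ^ (α * φ) * t ^ (α * φ - 1) := by
        rw [Real.mul_rpow hlam.le ht.le, ← mul_assoc, Real.rpow_sub_one hlam.ne']
        field_simp
      simp only [gwlPdf, hw, p1]
      rw [← hC]
      calc _ = α * (lam ^ (α * φ) * t ^ (α * φ - 1)) * (lam + (lam * t) ^ α) *
            Real.exp (-(lam * t) ^ α) / C := by ring
        _ = _ := by rw [← p3, ← p2]; ring
    have e2 : Real.log (gwlPdf φ lam α t) = K + c * Real.log ((lam * t) ^ α) +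
        Real.log (lam + (lam * t) ^ α) - (lam * t) ^ α := by
      unfold gwlPdf
      rw [← hC, Real.log_div (by positivity) hCpos.ne', Real.log_mul (by positivity) (by positivity),
        Real.log_mul (by positivity) (by positivity), Real.log_mul (by positivity) (by positivity),
        Real.log_mul (by positivity) (by positivity), Real.log_exp, Real.log_rpow hlam,
        Real.log_rpow ht, Real.log_rpow hu, Real.log_mul hlam.ne' ht.ne', hK, hc]
      field_simp
      ring
    simp only [smul_eq_mul, hF]
    rw [e2, e1]
    ring
  -- integrability
  have i0 : IntegrableOn w (Set.Ioi 0) := by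
    refine (Real.GammaIntegral_convergent hφ).congr_fun (fun y _ => ?_) measurableSet_Ioi
    simp only [hw]; ring
  have sh1 : ∀ y ∈ Set.Ioi (0 : ℝ), Real.exp (-y) * y ^ (φ + 1 - 1) = y * w y := by
    intro y hy
    rw [gwl_shift φ 1 y hy, Real.rpow_one]; simp only [hw]; ring
  have sh2 : ∀ y ∈ Set.Ioi (0 : ℝ), Real.exp (-y) * y ^ (φ + 2 - 1) = y ^ 2 * w y := by
    intro y hy
    rw [gwl_shift φ 2 y hy, Real.rpow_two]; simp only [hw]; ring
  have shl : ∀ y ∈ Set.Ioi (0 : ℝ), Real.log y * (y ^ (φ + 1 - 1) * Real.exp (-y)) =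
      Real.log y * (y * w y) := by
    intro y hy
    rw [← sh1 y hy]; ring
  have i1 : IntegrableOn (fun y => y * w y) (Set.Ioi 0) :=
    (Real.GammaIntegral_convergent (by positivity : 0 < φ + 1)).congr_fun sh1 measurableSet_Ioi
  have i2 : IntegrableOn (fun y => y ^ 2 * w y) (Set.Ioi 0) :=
    (Real.GammaIntegral_convergent (by positivity : 0 < φ + 2)).congr_fun sh2 measurableSet_Ioi
  have v0 : ∫ y in Set.Ioi (0 : ℝ), w y = Real.Gamma φ := by
    rw [Real.Gamma_eq_integral hφ]
    refine setIntegral_congr_fun measurableSet_Ioi (fun y _ => ?_)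
    simp only [hw]; ring
  have v1 : ∫ y in Set.Ioi (0 : ℝ), y * w y = φ * Real.Gamma φ := by
    rw [← hG1, Real.Gamma_eq_integral (by positivity)]
    exact (setIntegral_congr_fun measurableSet_Ioi sh1).symm
  have v2 : ∫ y in Set.Ioi (0 : ℝ), y ^ 2 * w y = (φ + 1) * (φ * Real.Gamma φ) := by
    rw [← hG2, Real.Gamma_eq_integral (by positivity)]
    exact (setIntegral_congr_fun measurableSet_Ioi sh2).symm
  obtain ⟨j0, u0⟩ := gwl_log_integrable φ hφ
  obtain ⟨j1, u1⟩ := gwl_log_integrable (φ + 1) (by positivity)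
  rw [setIntegral_congr_fun measurableSet_Ioi shl, hD1] at u1
  replace j1 := j1.congr_fun shl measurableSet_Ioi
  change IntegrableOn (fun y => Real.log y * w y) _ at j0
  change ∫ y in Set.Ioi (0 : ℝ), Real.log y * w y = _ at u0
  have ie : IntegrableOn (fun y => (lam + y) * Real.log (lam + y) * w y) (Set.Ioi 0) := by
    have hb : IntegrableOn (fun y => lam * (|Real.log lam| + lam) * w y +
        ((|Real.log lam| + lam + lam) * (y * w y) + y ^ 2 * w y)) (Set.Ioi 0) :=
      (i0.const_mul _).add ((i1.const_mul _).add i2)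
    refine Integrable.mono' hb ?_ ?_
    · apply Measurable.aestronglyMeasurable
      simp only [hw]
      fun_prop
    · refine (ae_restrict_iff' measurableSet_Ioi).mpr (Filter.Eventually.of_forall fun y hy => ?_)
      have hy : 0 < y := hy
      have hwy : 0 < w y := by simp only [hw]; positivity
      have hl : |Real.log (lam + y)| ≤ |Real.log lam| + lam + y := by
        rw [abs_le]
        have a1 := Real.log_le_log hlam (by linarith : lam ≤ lam + y)
        have a2 := neg_abs_le (Real.log lam)
        have a3 := Real.log_le_self (by positivity : 0 ≤ lam + y)
        have a4 := abs_nonneg (Real.log lam)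
        constructor <;> linarith
      rw [Real.norm_eq_abs, abs_mul, abs_mul, abs_of_pos hwy, abs_of_pos (by positivity : 0 < lam + y)]
      calc _ ≤ (lam + y) * (|Real.log lam| + lam + y) * w y := by gcongr
        _ = _ := by ring
  have ve : ∫ y in Set.Ioi (0 : ℝ), (lam + y) * Real.log (lam + y) * w y = etaAux φ lam := by
    unfold etaAux
    refine setIntegral_congr_fun measurableSet_Ioi (fun y _ => ?_)
    simp only [hw]; ring
  have hexp : ∀ y, F y = K * lam / C * w y + ((K - lam) / C * (y * w y) + (-1 / C * (y ^ 2 * w y) +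
      (c * lam / C * (Real.log y * w y) + (c / C * (Real.log y * (y * w y)) +
        1 / C * ((lam + y) * Real.log (lam + y) * w y))))) := by
    intro y; simp only [hF]; ring
  have k5 := (j1.const_mul (c / C)).add (ie.const_mul (1 / C))
  have k4 := (j0.const_mul (c * lam / C)).add k5
  have k3 := (i2.const_mul (-1 / C)).add k4
  have k2 := (i1.const_mul ((K - lam) / C)).add k3
  simp only [Pi.add_def] at k2 k3 k4 k5
  rw [hcv]
  simp_rw [hexp]
  rw [integral_add (i0.const_mul _) k2, integral_add (i1.const_mul _) k3,
    integral_add (i2.const_mul _) k4, integral_add (j0.const_mul _) k5,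
    integral_add (j1.const_mul _) (ie.const_mul _)]
  simp only [integral_const_mul]
  rw [v0, v1, v2, u0, u1, ve, hK, hc, hC, digamma, Real.log_mul (by positivity) (by positivity)]
  field_simp
  ring
end
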